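/- Let a, b : ℕ → ℝ be sequences with values in [0,1] whose ranges are finite sets, and for each i ∈ ℕ define c(i) = min(b(i), inf({a(j) : j < i} ∪ {1})). Then the supremum U = sup{c(i) : i ∈ ℕ} is attained, i.e., there exists i ∈ ℕ with c(i) = U, and U belongs to range(a) ∪ range(b). -/

import Mathlib

/-- A single term of the quantitative until is one of the values of the two sequences. -/
theorem min_sInf_mem_range_union (a b : ℕ → ℝ) (i : ℕ) (hb : b i ≤ 1) :
    min (b i) (sInf ({x | ∃ j < i, a j = x} ∪ {1})) ∈ Set.range a ∪ Set.range b := by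
  have hfin : ({x | ∃ j < i, a j = x} ∪ {1} : Set ℝ).Finite :=
    ((Set.finite_Iio i).image a).union (Set.finite_singleton 1)
  have hne : ({x | ∃ j < i, a j = x} ∪ {1} : Set ℝ).Nonempty := ⟨1, Or.inr rfl⟩
  rcases hne.csInf_mem hfin with ⟨j, -, hj⟩ | h1
  · rw [← hj]
    rcases min_choice (b i) (a j) with h | h <;> rw [h]
    · exact Or.inr ⟨i, rfl⟩
    · exact Or.inl ⟨j, rfl⟩
  · rw [Set.mem_singleton_iff.mp h1, min_eq_left hb]
    exact Or.inr ⟨i, rfl⟩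

/-- Quantitative until over sequences with finite range: the supremum
`U = sup_i min(b i, inf({a j : j < i} ∪ {1}))` is attained, and lies in
`range a ∪ range b`. -/
theorem stmt5 (a b : ℕ → ℝ)
    (ha : ∀ i, a i ∈ Set.Icc (0 : ℝ) 1) (hb : ∀ i, b i ∈ Set.Icc (0 : ℝ) 1)
    (hra : (Set.range a).Finite) (hrb : (Set.range b).Finite)
    (c : ℕ → ℝ)
    (hc : ∀ i, c i = min (b i) (sInf ({x | ∃ j < i, a j = x} ∪ {1}))) :
    ∃ i : ℕ, c i = sSup (Set.range c) ∧
      sSup (Set.range c) ∈ Set.range a ∪ Set.range b := by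
  have hsub : Set.range c ⊆ Set.range a ∪ Set.range b := by
    rintro _ ⟨i, rfl⟩
    rw [hc i]
    exact min_sInf_mem_range_union a b i (hb i).2
  have hmem : sSup (Set.range c) ∈ Set.range c :=
    (Set.range_nonempty c).csSup_mem ((hra.union hrb).subset hsub)
  obtain ⟨i, hi⟩ := hmem
  exact ⟨i, hi, hsub ⟨i, hi⟩⟩
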